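/- Fix m ≥ 3, α ∈ [1 − 1/m, 1], and rankings R_1,…,R_n over A_m, and let ≻_1,…,≻_n be mutually independent random rankings with ≻_i drawn from the α-IC distribution π_{R_i}. Fix an alternative a ∈ A_m and let β = (3/4 − 1/(2m))·n/m. Then with probability at least 1 − 2(m−1)·exp(−n/(72 m²)), it holds simultaneously for every alternative b ≠ a that #{i ∈ [n] : a ≺_i b} ≤ n/2 + β and #{i ∈ [n] : a ⋖_i b} ≥ β. -/

import Mathlib

open Finset
open scoped Classical

/-- A ranking over `m` alternatives: `R a` is the position of alternative `a`,
position `0` being the top. -/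
abbrev Ranking (m : ℕ) := Fin m ≃ Fin m

/-- The `α`-Impartial-Culture distribution centered at the ranking `R`: each ranking
`R'` gets probability `α/m! + (1−α)·1[R' = R]`. -/
noncomputable def alphaIC {m : ℕ} (α : ℝ) (R : Ranking m) : Ranking m → ℝ :=
  fun R' => α / (Nat.factorial m : ℝ) + (1 - α) * (if R' = R then 1 else 0)

/-- Probability of the event `Ev` when the `n` voters' rankings are drawn mutually
independently, voter `i`'s ranking from the distribution `π i` (product measure). -/
noncomputable def profileProb {n m : ℕ} (π : Fin n → Ranking m → ℝ)
    (Ev : (Fin n → Ranking m) → Prop) : ℝ :=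
  ∑ P ∈ univ.filter Ev, ∏ i : Fin n, π i (P i)

theorem bernoulli_mgf_le {p : ℝ} (h0 : 0 ≤ p) (h1 : p ≤ 1) (s : ℝ) :
    1 - p + p * Real.exp s ≤ Real.exp (s * p + s ^ 2 / 8) := by
  let μ : MeasureTheory.Measure ℝ :=
    ENNReal.ofReal (1 - p) • MeasureTheory.Measure.dirac 0 +
      ENNReal.ofReal p • MeasureTheory.Measure.dirac 1
  have hprob : MeasureTheory.IsProbabilityMeasure μ := ⟨by
    simp only [μ, MeasureTheory.Measure.add_apply, MeasureTheory.Measure.smul_apply,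
      MeasureTheory.measure_univ, smul_eq_mul, mul_one]
    rw [← ENNReal.ofReal_add (by linarith) h0]
    simp⟩
  have hint : ∀ f : ℝ → ℝ, ∫ x, f x ∂μ = (1 - p) * f 0 + p * f 1 := by
    intro f
    rw [MeasureTheory.integral_add_measure, MeasureTheory.integral_smul_measure,
      MeasureTheory.integral_smul_measure, MeasureTheory.integral_dirac,
      MeasureTheory.integral_dirac, ENNReal.toReal_ofReal (by linarith),
      ENNReal.toReal_ofReal h0, smul_eq_mul, smul_eq_mul]
    · exact (MeasureTheory.integrable_dirac (by simp)).smul_measure ENNReal.ofReal_ne_top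
    · exact (MeasureTheory.integrable_dirac (by simp)).smul_measure ENNReal.ofReal_ne_top
  have hmem : ∀ᵐ x ∂μ, (fun x : ℝ => x) x ∈ Set.Icc (0 : ℝ) 1 := by
    rw [MeasureTheory.ae_add_measure_iff]
    constructor
    · exact MeasureTheory.Measure.ae_smul_measure
        ((MeasureTheory.ae_dirac_iff measurableSet_Icc).2 (by simp)) _
    · exact MeasureTheory.Measure.ae_smul_measure
        ((MeasureTheory.ae_dirac_iff measurableSet_Icc).2 (by simp)) _
  have h := (ProbabilityTheory.hasSubgaussianMGF_of_mem_Icc measurable_id.aemeasurable hmem).mgf_le s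
  rw [ProbabilityTheory.mgf, hint, hint] at h
  norm_num at h
  have e1 : 1 - p + p * Real.exp s =
      Real.exp (s * p) * ((1 - p) * Real.exp (-(s * p)) + p * Real.exp (s * (1 - p))) := by
    have := Real.exp_add (s * p) (-(s * p))
    have h2 := Real.exp_add (s * p) (s * (1 - p))
    rw [show s * p + -(s * p) = 0 by ring, Real.exp_zero] at this
    rw [show s * p + s * (1 - p) = s by ring] at h2
    rw [h2]
    linear_combination (1 - p) * this
  rw [e1, Real.exp_add]
  refine mul_le_mul_of_nonneg_left (h.trans (le_of_eq ?_)) (Real.exp_pos _).le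
  congr 1
  ring

section ProductWeights

variable {n m : ℕ} {π : Fin n → Ranking m → ℝ}

theorem profileProb_mono (h0 : ∀ i r, 0 ≤ π i r) {E F : (Fin n → Ranking m) → Prop}
    (h : ∀ P, E P → F P) : profileProb π E ≤ profileProb π F := by
  refine Finset.sum_le_sum_of_subset_of_nonneg ?_ fun P _ _ => Finset.prod_nonneg fun i _ => h0 i _
  intro P
  simpa using h P

theorem profileProb_add_not (h1 : ∀ i, ∑ r, π i r = 1) (E : (Fin n → Ranking m) → Prop) :
    profileProb π E + profileProb π (fun P => ¬ E P) = 1 := by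
  unfold profileProb
  rw [Finset.sum_filter_add_sum_filter_not, ← Fintype.prod_sum]
  simp [h1]

theorem one_sub_le_profileProb (h1 : ∀ i, ∑ r, π i r = 1) {E : (Fin n → Ranking m) → Prop}
    {c : ℝ} (h : profileProb π (fun P => ¬ E P) ≤ c) : 1 - c ≤ profileProb π E := by
  have := profileProb_add_not h1 E
  linarith

theorem profileProb_or_le (h0 : ∀ i r, 0 ≤ π i r) (E F : (Fin n → Ranking m) → Prop) :
    profileProb π (fun P => E P ∨ F P) ≤ profileProb π E + profileProb π F := by
  unfold profileProb
  simp only [Finset.sum_filter]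
  rw [← Finset.sum_add_distrib]
  refine Finset.sum_le_sum fun P _ => ?_
  have := Finset.prod_nonneg fun i (_ : i ∈ (univ : Finset (Fin n))) => h0 i (P i)
  by_cases hE : E P <;> by_cases hF : F P <;> simp [hE, hF, this]

theorem profileProb_exists_le {ι : Type*} (h0 : ∀ i r, 0 ≤ π i r) (s : Finset ι)
    (E : ι → (Fin n → Ranking m) → Prop) :
    profileProb π (fun P => ∃ b ∈ s, E b P) ≤ ∑ b ∈ s, profileProb π (E b) := by
  induction s using Finset.induction_on with
  | empty => simp [profileProb]
  | insert b s hb ih =>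
    rw [Finset.sum_insert hb]
    refine le_trans ?_ (add_le_add_right ih _)
    refine le_trans (le_of_eq ?_) (profileProb_or_le h0 _ _)
    congr 1
    ext P
    simp

/-- Hoeffding's inequality for the number of voters whose ranking lies in a given set. -/
theorem profileProb_card_ge_le (h0 : ∀ i r, 0 ≤ π i r) (h1 : ∀ i, ∑ r, π i r = 1)
    (E : Ranking m → Prop) [DecidablePred E] {p ε : ℝ} (hε : 0 ≤ ε)
    (hp : ∀ i, ∑ r ∈ univ.filter E, π i r ≤ p) :
    profileProb π (fun P => (n : ℝ) * (p + ε) ≤ ((univ.filter fun i => E (P i)).card : ℝ)) ≤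
      Real.exp (-2 * n * ε ^ 2) := by
  set s : ℝ := 4 * ε with hs
  have hs0 : 0 ≤ s := by positivity
  have hmgf : ∀ i, ∑ r, π i r * Real.exp (s * if E r then 1 else 0) ≤
      Real.exp (s * p + s ^ 2 / 8) := by
    intro i
    have hsplit := Finset.sum_filter_add_sum_filter_not univ E (π i)
    rw [h1] at hsplit
    set q := ∑ r ∈ univ.filter E, π i r with hq
    have hq0 : 0 ≤ q := Finset.sum_nonneg fun r _ => h0 i r
    have hq1 : 0 ≤ ∑ r ∈ univ.filter (fun r => ¬ E r), π i r :=
      Finset.sum_nonneg fun r _ => h0 i r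
    have e : ∑ r, π i r * Real.exp (s * if E r then 1 else 0) = 1 - q + q * Real.exp s := by
      have : ∀ r, π i r * Real.exp (s * if E r then 1 else 0) =
          π i r + (if E r then π i r else 0) * (Real.exp s - 1) := by
        intro r
        split_ifs <;> simp
        ring
      simp only [this]
      rw [Finset.sum_add_distrib, h1, ← Finset.sum_mul, ← Finset.sum_filter, ← hq]
      ring
    rw [e]
    refine (bernoulli_mgf_le hq0 (by linarith) s).trans (Real.exp_le_exp.2 ?_)
    have := mul_le_mul_of_nonneg_left (hp i) hs0
    linarith
  have hmarkov : profileProb π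
      (fun P => (n : ℝ) * (p + ε) ≤ ((univ.filter fun i => E (P i)).card : ℝ)) ≤
      ∑ P : Fin n → Ranking m, Real.exp (-(s * (n * (p + ε)))) *
        ∏ i, (π i (P i) * Real.exp (s * if E (P i) then 1 else 0)) := by
    unfold profileProb
    rw [Finset.sum_filter]
    refine Finset.sum_le_sum fun P _ => ?_
    have hw := Finset.prod_nonneg fun i (_ : i ∈ (univ : Finset (Fin n))) => h0 i (P i)
    rw [Finset.prod_mul_distrib, ← Real.exp_sum, ← Finset.mul_sum, Finset.sum_boole,
      mul_left_comm, ← Real.exp_add]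
    split_ifs with h
    · refine le_mul_of_one_le_right hw (Real.one_le_exp ?_)
      have := mul_le_mul_of_nonneg_left h hs0
      linarith
    · positivity
  refine hmarkov.trans ?_
  rw [← Finset.mul_sum,
    ← Fintype.prod_sum fun i r => π i r * Real.exp (s * if E r then 1 else 0)]
  have hprod : ∏ i, ∑ r, π i r * Real.exp (s * if E r then 1 else 0) ≤
      Real.exp (s * p + s ^ 2 / 8) ^ n := by
    refine (Finset.prod_le_prod (fun i _ => Finset.sum_nonneg fun r _ =>
      mul_nonneg (h0 i r) (Real.exp_pos _).le) fun i _ => hmgf i).trans (le_of_eq ?_)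
    simp
  refine (mul_le_mul_of_nonneg_left hprod (Real.exp_pos _).le).trans (le_of_eq ?_)
  rw [← Real.exp_nat_mul, ← Real.exp_add]
  congr 1
  rw [hs]
  ring

end ProductWeights

section Counting

variable {m : ℕ}

theorem card_ranking_lt_add_self {a b : Fin m} (hab : b ≠ a) :
    (univ.filter fun σ : Ranking m => σ b < σ a).card +
      (univ.filter fun σ : Ranking m => σ b < σ a).card = m.factorial := by
  have hc : (univ.filter fun σ : Ranking m => ¬ σ b < σ a).card =
      (univ.filter fun σ : Ranking m => σ b < σ a).card := by
    refine Finset.card_equiv ((Equiv.swap a b).equivCongr (Equiv.refl _)) fun σ => ?_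
    have : σ a ≠ σ b := fun h => hab (σ.injective h).symm
    simp
    omega
  have := Finset.card_filter_add_card_filter_not (s := (univ : Finset (Ranking m)))
    (fun σ => σ b < σ a)
  rw [hc] at this
  rw [this, Finset.card_univ, Fintype.card_perm, Fintype.card_fin]

theorem mul_card_ranking_apply_eq (a k : Fin m) :
    m * (univ.filter fun σ : Ranking m => σ a = k).card = m.factorial := by
  have hc : ∀ j ∈ (univ : Finset (Fin m)), (univ.filter fun σ : Ranking m => σ a = j).card =
      (univ.filter fun σ : Ranking m => σ a = k).card := by
    intro j _
    refine Finset.card_equiv ((Equiv.refl _).equivCongr (Equiv.swap j k)) fun σ => ?_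
    simp [Equiv.swap_apply_eq_iff]
  have := Finset.card_eq_sum_card_fiberwise (s := (univ : Finset (Ranking m)))
    (t := (univ : Finset (Fin m))) (f := fun σ => σ a) (by simp)
  rw [Finset.sum_congr rfl hc] at this
  simpa [Fintype.card_perm] using this.symm

theorem mul_card_ranking_immediately_above {a b : Fin m} (hab : b ≠ a) :
    m * (univ.filter fun σ : Ranking m => (σ a : ℕ) = (σ b : ℕ) + 1).card = m.factorial := by
  have hm : 0 < m := a.pos
  set N := (univ.filter fun σ : Ranking m => (σ a : ℕ) = (σ b : ℕ) + 1).card with hN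
  have hc : ∀ c ∈ univ.erase a,
      (univ.filter fun σ : Ranking m => (σ a : ℕ) = (σ c : ℕ) + 1).card = N := by
    intro c hc
    refine Finset.card_equiv ((Equiv.swap b c).equivCongr (Equiv.refl _)) fun σ => ?_
    have hca : c ≠ a := Finset.ne_of_mem_erase hc
    simp [Equiv.swap_apply_of_ne_of_ne hab.symm hca.symm]
  have hsum : (univ.filter fun σ : Ranking m => ¬ σ a = ⟨0, hm⟩).card =
      ∑ c ∈ univ.erase a,
        (univ.filter fun σ : Ranking m => (σ a : ℕ) = (σ c : ℕ) + 1).card := by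
    rw [← Finset.card_biUnion]
    · congr 1
      ext σ
      simp only [Finset.mem_filter, Finset.mem_univ, true_and, Finset.mem_biUnion,
        Finset.mem_erase, and_true, Fin.ext_iff]
      constructor
      · intro h
        have hlt : (σ a : ℕ) - 1 < m := by omega
        refine ⟨σ.symm ⟨(σ a : ℕ) - 1, hlt⟩, ?_, ?_⟩
        · intro h'
          have := congrArg (fun x => (σ x : ℕ)) h'
          simp at this
          omega
        · simp
          omega
      · rintro ⟨c, _, h⟩
        omega
    · intro c _ d _ hcd
      refine Finset.disjoint_left.2 fun σ h h' => hcd (σ.injective (Fin.ext ?_))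
      simp at h h'
      omega
  rw [Finset.sum_congr rfl hc, Finset.sum_const, Finset.card_erase_of_mem (Finset.mem_univ a),
    Finset.card_univ, Fintype.card_fin, smul_eq_mul] at hsum
  have htot := Finset.card_filter_add_card_filter_not (s := (univ : Finset (Ranking m)))
    (fun σ => σ a = ⟨0, hm⟩)
  rw [hsum, Finset.card_univ, Fintype.card_perm, Fintype.card_fin] at htot
  have hz := mul_card_ranking_apply_eq a ⟨0, hm⟩
  set K := (univ.filter fun σ : Ranking m => σ a = ⟨0, hm⟩).card
  obtain ⟨k, rfl⟩ : ∃ k, m = k + 1 := ⟨m - 1, by omega⟩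
  have hk : 0 < k := by
    by_contra h
    obtain rfl : k = 0 := by omega
    exact hab (Fin.ext (by omega))
  have hKN : K = N := by
    have : k * K = k * N := by
      simp only [Nat.add_sub_cancel] at htot
      linarith
    exact Nat.eq_of_mul_eq_mul_left hk this
  rw [← hKN, hz]

end Counting

section AlphaIC

variable {m : ℕ} {α : ℝ}

theorem alphaIC_nonneg (h0 : 0 ≤ α) (h1 : α ≤ 1) (R r : Ranking m) : 0 ≤ alphaIC α R r := by
  unfold alphaIC
  have : 0 ≤ 1 - α := by linarith
  positivity

theorem sum_filter_alphaIC (R : Ranking m) (E : Ranking m → Prop) [DecidablePred E] :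
    ∑ r ∈ univ.filter E, alphaIC α R r =
      α / (m.factorial : ℝ) * ((univ.filter E).card : ℝ) +
        (1 - α) * (if E R then 1 else 0) := by
  unfold alphaIC
  rw [Finset.sum_add_distrib, Finset.sum_const, ← Finset.mul_sum, Finset.sum_ite_eq']
  simp [mul_comm]

theorem sum_alphaIC (R : Ranking m) : ∑ r, alphaIC α R r = 1 := by
  have h := sum_filter_alphaIC (α := α) R (fun _ => True)
  have hm : (m.factorial : ℝ) ≠ 0 := by positivity
  simp only [Finset.filter_true, if_true, Finset.card_univ, Fintype.card_perm,
    Fintype.card_fin] at h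
  rw [h]
  field_simp
  ring

theorem alphaIC_prefers_le (h1 : α ≤ 1) (R : Ranking m) {a b : Fin m} (hab : b ≠ a) :
    ∑ r ∈ univ.filter (fun r : Ranking m => r b < r a), alphaIC α R r ≤ 1 - α / 2 := by
  have hm : (m.factorial : ℝ) ≠ 0 := by positivity
  have hN : ((univ.filter fun σ : Ranking m => σ b < σ a).card : ℝ) = m.factorial / 2 := by
    have := card_ranking_lt_add_self hab
    have : ((univ.filter fun σ : Ranking m => σ b < σ a).card : ℝ) +
      (univ.filter fun σ : Ranking m => σ b < σ a).card = m.factorial := by exact_mod_cast this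
    linarith
  have e := sum_filter_alphaIC (α := α) R (fun r : Ranking m => r b < r a)
  have e2 : α / (m.factorial : ℝ) * (m.factorial / 2) = α / 2 := by field_simp
  have hle : (1 - α) * (if R b < R a then (1 : ℝ) else 0) ≤ 1 - α := by
    split_ifs <;> linarith
  rw [hN, e2] at e
  rw [e]
  linarith

theorem le_alphaIC_immediately_above (h1 : α ≤ 1) (R : Ranking m) {a b : Fin m} (hab : b ≠ a) :
    α / m ≤ ∑ r ∈ univ.filter (fun r : Ranking m => (r a : ℕ) = (r b : ℕ) + 1),
      alphaIC α R r := by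
  have hm : (m.factorial : ℝ) ≠ 0 := by positivity
  have hm' : (m : ℝ) ≠ 0 := by exact_mod_cast a.pos.ne'
  have hN : (m : ℝ) * ((univ.filter fun σ : Ranking m => (σ a : ℕ) = (σ b : ℕ) + 1).card : ℝ) =
      m.factorial := by exact_mod_cast mul_card_ranking_immediately_above hab
  have e := sum_filter_alphaIC (α := α) R (fun r : Ranking m => (r a : ℕ) = (r b : ℕ) + 1)
  set N := ((univ.filter fun σ : Ranking m => (σ a : ℕ) = (σ b : ℕ) + 1).card : ℝ)
  have e2 : α / (m.factorial : ℝ) * N = α / m := by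
    field_simp
    linear_combination α * hN
  have hle : 0 ≤ (1 - α) * (if (R a : ℕ) = (R b : ℕ) + 1 then (1 : ℝ) else 0) := by
    split_ifs <;> linarith
  rw [e2] at e
  rw [e]
  linarith

end AlphaIC

/-- with each voter `i` drawing independently from the `α`-IC
distribution `π_{R i}` (`1 − 1/m ≤ α ≤ 1`), for a fixed alternative `a` and
`β = (3/4 − 1/(2m))·n/m`, with probability at least `1 − 2(m−1)·exp(−n/(72m²))`,
simultaneously for every `b ≠ a`: at most `n/2 + β` voters prefer `b` to `a`, and
at least `β` voters rank `b` immediately above `a`. -/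
theorem alphaIC_good_event (m n : ℕ) (hm : 3 ≤ m) (α : ℝ)
    (hα1 : 1 - 1 / (m : ℝ) ≤ α) (hα2 : α ≤ 1)
    (R : Fin n → Ranking m) (a : Fin m) :
    1 - 2 * ((m : ℝ) - 1) * Real.exp (-(n : ℝ) / (72 * (m : ℝ) ^ 2)) ≤
      profileProb (fun i => alphaIC α (R i))
        (fun P => ∀ b : Fin m, b ≠ a →
          (((univ.filter fun i => P i b < P i a).card : ℝ) ≤
            (n : ℝ) / 2 + (3 / 4 - 1 / (2 * (m : ℝ))) * (n : ℝ) / (m : ℝ)) ∧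
          ((3 / 4 - 1 / (2 * (m : ℝ))) * (n : ℝ) / (m : ℝ) ≤
            ((univ.filter fun i => (P i a : ℕ) = (P i b : ℕ) + 1).card : ℝ))) := by
  have hm3 : (3 : ℝ) ≤ m := by exact_mod_cast hm
  have hm0 : (0 : ℝ) < m := by linarith
  have hinv : (1 : ℝ) / m ≤ 1 / 3 := one_div_le_one_div_of_le (by norm_num) hm3
  set x : ℝ := 1 / m with hx
  have hx0 : 0 < x := by positivity
  have hα0 : 0 ≤ α := by linarith
  have hn0 : (0 : ℝ) ≤ n := n.cast_nonneg
  have hβ : (3 / 4 - 1 / (2 * (m : ℝ))) * (n : ℝ) / (m : ℝ) = n * ((3 / 4 - x / 2) * x) := by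
    rw [hx]
    field_simp
  have hexp : -2 * (n : ℝ) * (x / 12) ^ 2 = -(n : ℝ) / (72 * (m : ℝ) ^ 2) := by
    rw [hx]
    field_simp
    ring
  rw [hβ]
  set δ := Real.exp (-(n : ℝ) / (72 * (m : ℝ) ^ 2)) with hδ
  set π : Fin n → Ranking m → ℝ := fun i => alphaIC α (R i)
  have h0 : ∀ i r, 0 ≤ π i r := fun i r => alphaIC_nonneg hα0 hα2 _ _
  have h1 : ∀ i, ∑ r, π i r = 1 := fun i => sum_alphaIC _
  have hprefer : ∀ b : Fin m, b ≠ a → profileProb π (fun P =>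
      ¬ ((univ.filter fun i => P i b < P i a).card : ℝ) ≤
        (n : ℝ) / 2 + n * ((3 / 4 - x / 2) * x)) ≤ δ := by
    intro b hb
    have h := profileProb_card_ge_le h0 h1 (fun r : Ranking m => r b < r a)
      (by positivity : 0 ≤ x / 12)
      (fun i => alphaIC_prefers_le hα2 (R i) hb)
    rw [hexp] at h
    refine le_trans (profileProb_mono h0 fun P hP => ?_) h
    have hbound : 1 - α / 2 + x / 12 ≤ 1 / 2 + (3 / 4 - x / 2) * x := by nlinarith
    have := mul_le_mul_of_nonneg_left hbound hn0
    push Not at hP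
    have hP' := hP.le
    linarith
  have habove : ∀ b : Fin m, b ≠ a → profileProb π (fun P =>
      ¬ n * ((3 / 4 - x / 2) * x) ≤
        ((univ.filter fun i => (P i a : ℕ) = (P i b : ℕ) + 1).card : ℝ)) ≤ δ := by
    intro b hb
    have h := profileProb_card_ge_le (p := 1 - α * x) h0 h1
      (fun r : Ranking m => ¬ (r a : ℕ) = (r b : ℕ) + 1)
      (by positivity : 0 ≤ x / 12) (fun i => by
        have hs := Finset.sum_filter_add_sum_filter_not univ
          (fun r : Ranking m => (r a : ℕ) = (r b : ℕ) + 1) (π i)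
        have hl := le_alphaIC_immediately_above hα2 (R i) hb
        rw [h1] at hs
        rw [hx, mul_one_div]
        linarith)
    rw [hexp] at h
    refine le_trans (profileProb_mono h0 fun P hP => ?_) h
    have hbound : 1 - α * x + x / 12 ≤ 1 - (3 / 4 - x / 2) * x := by nlinarith
    have := mul_le_mul_of_nonneg_left hbound hn0
    push Not at hP
    have hcard := Finset.card_filter_add_card_filter_not (s := (univ : Finset (Fin n)))
      (fun i => (P i a : ℕ) = (P i b : ℕ) + 1)
    rw [Finset.card_univ, Fintype.card_fin] at hcard
    have hcard' : ((univ.filter fun i => (P i a : ℕ) = (P i b : ℕ) + 1).card : ℝ) +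
      ((univ.filter fun i => ¬ (P i a : ℕ) = (P i b : ℕ) + 1).card : ℝ) = n := by
      exact_mod_cast hcard
    linarith
  refine one_sub_le_profileProb h1 ?_
  calc _ ≤ profileProb π (fun P => ∃ b ∈ univ.erase a,
          (¬ ((univ.filter fun i => P i b < P i a).card : ℝ) ≤
            (n : ℝ) / 2 + n * ((3 / 4 - x / 2) * x)) ∨
          ¬ n * ((3 / 4 - x / 2) * x) ≤
            ((univ.filter fun i => (P i a : ℕ) = (P i b : ℕ) + 1).card : ℝ)) := by
        refine profileProb_mono h0 fun P hP => ?_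
        push Not at hP
        obtain ⟨b, hb, hP⟩ := hP
        refine ⟨b, by simp [hb], ?_⟩
        rw [or_iff_not_imp_left, not_not, not_le]
        exact hP
    _ ≤ ∑ b ∈ univ.erase a, (δ + δ) := by
        refine (profileProb_exists_le h0 _ _).trans (Finset.sum_le_sum fun b hb => ?_)
        have hb := Finset.ne_of_mem_erase hb
        exact (profileProb_or_le h0 _ _).trans (add_le_add (hprefer b hb) (habove b hb))
    _ = 2 * ((m : ℝ) - 1) * δ := by
        rw [Finset.sum_const, Finset.card_erase_of_mem (Finset.mem_univ a), Finset.card_univ,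
          Fintype.card_fin, nsmul_eq_mul, Nat.cast_sub (by omega), Nat.cast_one]
        ring
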